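/- The bracket relations of the twisted N=1 Schrödinger-Neveu-Schwarz algebra satisfy the super Jacobi identity; that is, the vector space with basis {L_n, G_r, Y_p, M_p, c | n ∈ ℤ, r ∈ 1/2+ℤ, p ∈ (1/2)ℤ} and the given brackets forms a Lie superalgebra. -/

import Mathlib

noncomputable section

/-- Basis of the twisted N=1 Schrodinger-Neveu-Schwarz algebra.
`L n` is L_n, `G k` is G_{k+1/2}, `Y p` is Y_{p/2}, `M p` is M_{p/2}, `C` is the central element. -/
inductive B : Type
  | L : ℤ → B
  | G : ℤ → B
  | Y : ℤ → B
  | M : ℤ → B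
  | C : B
deriving DecidableEq

/-- The underlying vector space of tsns. -/
abbrev V := B →₀ ℂ

/-- Basis vectors. -/
def e (x : B) : V := Finsupp.single x 1

/-- Parity of a basis element. -/
def isOdd : B → Bool
  | .G _ => true
  | .Y p => if p % 2 = 0 then false else true
  | .M p => if p % 2 = 0 then false else true
  | _ => false

/-- The Koszul sign (-1)^{|x||y|}. -/
def sgn (x y : B) : ℂ := if isOdd x && isOdd y then -1 else 1

/-- The super-bracket on basis elements of tsns. -/
def bb : B → B → V
  | .L n, .L m => ((m : ℂ) - n) • e (.L (n+m)) +
      (if m = -n then (((n:ℂ)^3 - (n:ℂ))/12) • e B.C else 0)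
  | .L n, .G k => ((k : ℂ) + 1/2 - (n:ℂ)/2) • e (.G (k+n))
  | .G k, .L n => (-((k : ℂ) + 1/2 - (n:ℂ)/2)) • e (.G (k+n))
  | .G k, .G l => (2:ℂ) • e (.L (k+l+1)) +
      (if l = -k-1 then ((1 - 4*((k:ℂ)+1/2)^2)/12) • e B.C else 0)
  | .L n, .Y p => (if p % 2 = 0 then (p:ℂ)/2 - (n:ℂ)/2 else (p:ℂ)/2) • e (.Y (p + 2*n))
  | .Y p, .L n => (-(if p % 2 = 0 then (p:ℂ)/2 - (n:ℂ)/2 else (p:ℂ)/2)) • e (.Y (p + 2*n))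
  | .L n, .M p => (if p % 2 = 0 then (p:ℂ)/2 else (p:ℂ)/2 + (n:ℂ)/2) • e (.M (p + 2*n))
  | .M p, .L n => (-(if p % 2 = 0 then (p:ℂ)/2 else (p:ℂ)/2 + (n:ℂ)/2)) • e (.M (p + 2*n))
  | .G k, .Y p => (if p % 2 = 0 then ((p:ℂ)/2 - ((k:ℂ)+1/2))/2 else 2) • e (.Y (p + 2*k + 1))
  | .Y p, .G k => (if p % 2 = 0 then -(((p:ℂ)/2 - ((k:ℂ)+1/2))/2) else 2) • e (.Y (p + 2*k + 1))
  | .G k, .M p => (if p % 2 = 0 then (p:ℂ)/4 else 2) • e (.M (p + 2*k + 1))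
  | .M p, .G k => (if p % 2 = 0 then -((p:ℂ)/4) else 2) • e (.M (p + 2*k + 1))
  | .Y p, .Y q => (if p % 2 = 0 then (if q % 2 = 0 then ((q:ℂ) - p)/4 else (q:ℂ)/4)
      else (if q % 2 = 0 then -((p:ℂ)/4) else 2)) • e (.M (p + q))
  | _, _ => 0

/-- Bilinear extension of the bracket to all of tsns. -/
def br (f g : V) : V := f.sum fun x a => g.sum fun y b => (a * b) • bb x y

theorem br_add' (x : B) (f g : V) : br (e x) (f + g) = br (e x) f + br (e x) g := by
  unfold br e
  rw [Finsupp.sum_single_index (by simp), Finsupp.sum_single_index (by simp),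
    Finsupp.sum_single_index (by simp)]
  exact Finsupp.sum_add_index' (by simp) (by intros; simp [add_smul])

theorem br_zero' (x : B) : br (e x) 0 = 0 := by
  simp [br]

theorem br_smul' (x y : B) (a : ℂ) : br (e x) (a • e y) = a • bb x y := by
  unfold br e
  rw [Finsupp.sum_single_index (by simp), Finsupp.smul_single,
    Finsupp.sum_single_index (by simp)]
  simp

theorem br_ite' (x : B) (p : Prop) [Decidable p] (f : V) :
    br (e x) (if p then f else 0) = if p then br (e x) f else 0 := by
  split_ifs <;> simp [br_zero']

theorem kind' (P : B → Prop) (hL : ∀ n : ℤ, True → P (.L n)) (hG : ∀ n : ℤ, True → P (.G n))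
    (hY : ∀ n, n % 2 = 0 → P (.Y n)) (hY' : ∀ n, n % 2 = 1 → P (.Y n))
    (hM : ∀ n, n % 2 = 0 → P (.M n)) (hM' : ∀ n, n % 2 = 1 → P (.M n))
    (hC : ∀ n : ℤ, True → P .C) (x : B) : P x := by
  rcases x with n | n | n | n | _
  · exact hL n trivial
  · exact hG n trivial
  · rcases Int.emod_two_eq_zero_or_one n with h | h
    · exact hY n h
    · exact hY' n h
  · rcases Int.emod_two_eq_zero_or_one n with h | h
    · exact hM n h
    · exact hM' n h
  · exact hC 0 trivial

theorem skew' (x y : B) : bb x y = -(sgn x y • bb y x) := by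
  revert x y
  refine kind' _ ?_ ?_ ?_ ?_ ?_ ?_ ?_ <;> intro n <;> intro hn <;>
  refine kind' _ ?_ ?_ ?_ ?_ ?_ ?_ ?_ <;> intro m <;> intro hm <;>
  simp (disch := omega) only [bb, sgn, isOdd, if_pos, if_neg, Bool.and_true, Bool.and_false,
    Bool.true_and, Bool.false_and, Bool.false_eq_true, if_true, if_false, smul_zero, neg_zero] <;>
  first
  | (ring_nf; done)
  | (ring_nf; module)
  | (split_ifs with h1 h2 h2
     · subst h1
       push_cast
       ring_nf
       module
     · omega
     · omega
     · ring_nf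
       module)

set_option maxHeartbeats 0 in
set_option linter.unusedSimpArgs false in
theorem jac' (x y z : B) : sgn x z • br (e x) (bb y z) + sgn y x • br (e y) (bb z x)
        + sgn z y • br (e z) (bb x y) = 0 := by
  revert x y z
  refine kind' _ ?_ ?_ ?_ ?_ ?_ ?_ ?_ <;> intro n <;> intro hn <;>
  refine kind' _ ?_ ?_ ?_ ?_ ?_ ?_ ?_ <;> intro m <;> intro hm <;>
  refine kind' _ ?_ ?_ ?_ ?_ ?_ ?_ ?_ <;> intro k <;> intro hk <;>
  simp (disch := omega) only [bb, sgn, isOdd, if_pos, if_neg, Bool.and_true, Bool.and_false,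
    Bool.true_and, Bool.false_and, Bool.false_eq_true, if_true, if_false, smul_zero, neg_zero,
    br_add', br_zero', br_smul', br_ite', ite_self, add_zero, zero_add] <;>
  first
  | (push_cast; ring_nf; done)
  | (push_cast; ring_nf; module)
  | (split_ifs <;> first
     | omega
     | (push_cast; ring_nf; module)
     | (obtain rfl : n = - m - k := by omega
        push_cast; ring_nf; module)
     | (obtain rfl : n = - m - k - 1 := by omega
        push_cast; ring_nf; module))
  | skip

/-- the bracket relations of tsns satisfy super skew-symmetry and the super
Jacobi identity, i.e. tsns is a Lie superalgebra. -/
theorem tsns_is_lie_superalgebra :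
    (∀ x y : B, bb x y = -(sgn x y • bb y x)) ∧
    (∀ x y z : B,
      sgn x z • br (e x) (bb y z) + sgn y x • br (e y) (bb z x)
        + sgn z y • br (e z) (bb x y) = 0) := by
  exact ⟨skew', jac'⟩
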